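/- arXiv:1212.0209 — 2 statements merged into one kernel-verified Lean document; each statement's English description precedes it below -/
import Mathlib

section
/- Let i, j, n be positive integers with gcd(i, j) = 1, and let M = {i + kj : 0 ≤ k ≤ n−1} ∪ {j}. If i + nj ≡ n (mod n+1), then μ(M) ≥ (i + nj − n)/((n+1)(i + nj)). -/
open Filter Set Pointwise

/-- `countBelow S x` is the number of elements `n ∈ S` with `n ≤ x`. -/
noncomputable def countBelow (S : Set ℕ) (x : ℕ) : ℕ := (S ∩ Set.Iic x).ncard

/-- The upper asymptotic density `δ̄(S) = limsup_{x→∞} S(x)/x` of a set `S ⊆ ℕ`. -/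
noncomputable def upperDensity (S : Set ℕ) : ℝ :=
  Filter.limsup (fun x : ℕ => (countBelow S x : ℝ) / x) Filter.atTop

/-- `S` is an `M`-set: for all `a, b ∈ S`, the difference `a - b` does not lie in `M`. -/
def IsMSet (M S : Set ℕ) : Prop := ∀ a ∈ S, ∀ b ∈ S, a - b ∉ M

/-- Motzkin's quantity `μ(M)`: the supremum of the upper densities of all `M`-sets. -/
noncomputable def muM (M : Set ℕ) : ℝ :=
  sSup {x : ℝ | ∃ S : Set ℕ, IsMSet M S ∧ x = upperDensity S}

lemma countBelow_div_nonneg (S : Set ℕ) (x : ℕ) : 0 ≤ (countBelow S x : ℝ) / x := by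
  positivity

lemma countBelow_div_le_two (S : Set ℕ) (x : ℕ) : (countBelow S x : ℝ) / x ≤ 2 := by
  rcases Nat.eq_zero_or_pos x with rfl | hx
  · simp
  · have hcard : countBelow S x ≤ x + 1 := by
      calc (S ∩ Set.Iic x).ncard ≤ (Set.Iic x).ncard :=
            Set.ncard_le_ncard Set.inter_subset_right (Set.finite_Iic x)
        _ = x + 1 := by rw [← Finset.coe_Iic, Set.ncard_coe_finset, Nat.card_Iic]
    rw [div_le_iff₀ (by exact_mod_cast hx)]
    exact_mod_cast (show countBelow S x ≤ 2 * x by omega)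

lemma upperDensity_le_two (S : Set ℕ) : upperDensity S ≤ 2 :=
  Filter.limsup_le_of_le
    (Filter.isCoboundedUnder_le_of_le atTop (countBelow_div_nonneg S))
    (Filter.Eventually.of_forall (countBelow_div_le_two S))

lemma upperDensity_le_muM {M S : Set ℕ} (hS : IsMSet M S) : upperDensity S ≤ muM M := by
  refine le_csSup ⟨2, ?_⟩ ⟨S, hS, rfl⟩
  rintro x ⟨T, -, rfl⟩
  exact upperDensity_le_two T

/-- A set containing `q` distinct residue classes modulo `m` has upper density at least `q / m`. -/
lemma div_le_upperDensity {S : Set ℕ} {m q : ℕ} (hm : 0 < m) (r : ℕ → ℕ)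
    (hr : ∀ t < q, ∀ t' < q, r t ≡ r t' [MOD m] → t = t')
    (hS : ∀ t < q, ∀ s, s ≡ r t [MOD m] → s ∈ S) :
    (q : ℝ) / m ≤ upperDensity S := by
  refine Filter.le_limsup_of_frequently_le ?_
    ⟨2, Filter.eventually_map.2 (Filter.Eventually.of_forall (countBelow_div_le_two S))⟩
  refine Filter.frequently_atTop.2 fun N => ⟨(N + 1) * m, by nlinarith, ?_⟩
  have hcount : (N + 1) * q ≤ countBelow S ((N + 1) * m) := by
    let f : ℕ × ℕ → ℕ := fun p => p.1 * m + r p.2 % m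
    have hmod : ∀ p, f p ≡ r p.2 [MOD m] := fun p => by
      simp [f, Nat.ModEq]
    have hdiv : ∀ p, f p / m = p.1 := fun p => by
      simp only [f]
      rw [Nat.mul_comm, Nat.mul_add_div hm, Nat.div_eq_of_lt (Nat.mod_lt _ hm), add_zero]
    have hinj : Set.InjOn f (Finset.range (N + 1) ×ˢ Finset.range q : Finset (ℕ × ℕ)) := by
      intro p hp p' hp' h
      simp only [Finset.coe_product, Finset.coe_range, Set.mem_prod, Set.mem_Iio] at hp hp'
      refine Prod.ext ?_ (hr _ hp.2 _ hp'.2 ?_)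
      · rw [← hdiv p, h, hdiv]
      · exact (hmod p).symm.trans (h ▸ hmod p')
    have hsub : ((Finset.range (N + 1) ×ˢ Finset.range q).image f : Set ℕ) ⊆
        S ∩ Set.Iic ((N + 1) * m) := by
      intro s hs
      obtain ⟨p, hp, rfl⟩ := Finset.mem_image.1 (Finset.mem_coe.1 hs)
      rw [Finset.mem_product, Finset.mem_range, Finset.mem_range] at hp
      refine ⟨hS _ hp.2 _ (hmod p), ?_⟩
      have h1 : r p.2 % m < m := Nat.mod_lt _ hm
      have h2 : (p.1 + 1) * m ≤ (N + 1) * m := Nat.mul_le_mul_right m hp.1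
      simp only [Set.mem_Iic, f]
      linarith
    calc (N + 1) * q = ((Finset.range (N + 1) ×ˢ Finset.range q).image f).card := by
          rw [Finset.card_image_of_injOn hinj, Finset.card_product, Finset.card_range,
            Finset.card_range]
      _ ≤ countBelow S ((N + 1) * m) := by
          rw [← Set.ncard_coe_finset]
          exact Set.ncard_le_ncard hsub ((Set.finite_Iic _).subset Set.inter_subset_right)
  have hm' : (0 : ℝ) < m := by exact_mod_cast hm
  rw [div_le_div_iff₀ hm' (by push_cast; positivity)]
  have hcount' : ((N : ℝ) + 1) * q ≤ countBelow S ((N + 1) * m) := by exact_mod_cast hcount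
  push_cast
  nlinarith

/-- Distinct multiples of `n + 1` below `q * (n + 1)` are at cyclic distance more than `n`
modulo `m`, provided `q * (n + 1) ≤ m`. -/
lemma eq_of_mul_succ_add_modEq {m n q t t' c : ℕ} (hm : q * (n + 1) ≤ m) (ht : t < q)
    (ht' : t' < q) (hc : c ≤ n) (h : t * (n + 1) + c ≡ t' * (n + 1) [MOD m]) :
    c = 0 ∧ t = t' := by
  have h1 : (t + 1) * (n + 1) ≤ q * (n + 1) := Nat.mul_le_mul_right _ ht
  have h2 : (t' + 1) * (n + 1) ≤ q * (n + 1) := Nat.mul_le_mul_right _ ht'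
  have h3 : t * (n + 1) + c = t' * (n + 1) := h.eq_of_lt_of_lt (by linarith) (by linarith)
  have htt : t = t' := by
    have := congrArg (· / (n + 1)) h3
    simp only [Nat.mul_div_cancel _ (Nat.succ_pos n)] at this
    rwa [Nat.mul_comm, Nat.mul_add_div (Nat.succ_pos n), Nat.div_eq_of_lt (by omega),
      add_zero] at this
  subst htt
  exact ⟨by omega, rfl⟩

/-- Theorem 3 (second part): For `M = {i + kj : 0 ≤ k ≤ n-1} ∪ {j}` with `gcd(i,j) = 1`,
if `i + nj ≡ n (mod n+1)`, then `μ(M) ≥ (i + nj - n)/((n+1)(i + nj))`. -/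
theorem stmt7 (i j n : ℕ) (hi : 0 < i) (hj : 0 < j) (hn : 0 < n)
    (hgcd : Nat.gcd i j = 1)
    (M : Set ℕ) (hM : M = {m | ∃ k < n, m = i + k * j} ∪ {j})
    (hres : (i + n * j) % (n + 1) = n) :
    ((i : ℝ) + n * j - n) / (((n : ℝ) + 1) * ((i : ℝ) + n * j)) ≤ muM M := by
  set m := i + n * j with hm
  set q := m / (n + 1) with hq
  have hmq : m = q * (n + 1) + n := by
    have := Nat.div_add_mod m (n + 1)
    rw [hres, Nat.mul_comm] at this
    exact this.symm
  have hle : q * (n + 1) ≤ m := by omega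
  have hm0 : 0 < m := by omega
  have hcop : Nat.gcd m j = 1 := by
    rw [hm, Nat.gcd_add_mul_right_left]
    exact hgcd
  let S : Set ℕ := {s | ∃ t < q, s ≡ j * (t * (n + 1)) [MOD m]}
  have hS : IsMSet M S := by
    rintro a ⟨t, ht, ha⟩ b ⟨t', ht', hb⟩ hab
    rw [hM] at hab
    rcases hab with ⟨k, hk, hk'⟩ | hj'
    · have hab : a + (n - k) * j = b + m := by
        have h1 : n * j = k * j + (n - k) * j := by rw [← add_mul]; congr 1; omega
        omega
      have h2 : j * (t * (n + 1) + (n - k)) ≡ j * (t' * (n + 1)) [MOD m] := by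
        calc j * (t * (n + 1) + (n - k)) = j * (t * (n + 1)) + (n - k) * j := by ring
          _ ≡ a + (n - k) * j [MOD m] := ha.symm.add_right _
          _ = b + m := hab
          _ ≡ b [MOD m] := Nat.add_mod_right b m
          _ ≡ j * (t' * (n + 1)) [MOD m] := hb
      have := eq_of_mul_succ_add_modEq hle ht ht' (Nat.sub_le n k)
        (h2.cancel_left_of_coprime hcop)
      omega
    · have hab : a = b + j := by
        have : a - b = j := hj'
        omega
      have h2 : j * (t' * (n + 1) + 1) ≡ j * (t * (n + 1)) [MOD m] := by
        calc j * (t' * (n + 1) + 1) = j * (t' * (n + 1)) + j := by ring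
          _ ≡ b + j [MOD m] := hb.symm.add_right _
          _ = a := hab.symm
          _ ≡ j * (t * (n + 1)) [MOD m] := ha
      have := eq_of_mul_succ_add_modEq hle ht' ht hn (h2.cancel_left_of_coprime hcop)
      omega
  have hdens : (q : ℝ) / m ≤ upperDensity S :=
    div_le_upperDensity hm0 (fun t => j * (t * (n + 1)))
      (fun t ht t' ht' h => (eq_of_mul_succ_add_modEq (c := 0) hle ht ht' (Nat.zero_le n)
        (h.cancel_left_of_coprime hcop)).2)
      (fun t ht s hs => ⟨t, ht, hs⟩)
  have hmR : (i : ℝ) + n * j = m := by rw [hm]; push_cast; ring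
  have hnum : (m : ℝ) - n = (n + 1) * q := by rw [hmq]; push_cast; ring
  calc ((i : ℝ) + n * j - n) / (((n : ℝ) + 1) * ((i : ℝ) + n * j)) = (q : ℝ) / m := by
        rw [hmR, hnum, mul_div_mul_left _ _ (by positivity)]
    _ ≤ upperDensity S := hdens
    _ ≤ muM M := upperDensity_le_muM hS
end

section
/- Let M be a set of positive integers and let α be a real number with 0 ≤ α ≤ 1. Suppose that for every M-set S with 0 ∈ S there exists a positive integer k (possibly depending on S) such that S(k) ≤ (k+1)α. Then μ(M) ≤ α. -/
open Filter Set Pointwise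

open Classical in
theorem countBelow_eq_count (S : Set ℕ) (x : ℕ) :
    countBelow S x = Nat.count (· ∈ S) (x + 1) := by
  rw [countBelow, Nat.count_eq_card_filter_range, ← Set.ncard_coe_finset]
  congr 1
  ext n
  simp [and_comm]

theorem IsMSet.shift {M S : Set ℕ} (hS : IsMSet M S) (d : ℕ) : IsMSet M {n | d + n ∈ S} := by
  intro a ha b hb
  simpa [Nat.add_sub_add_left] using hS _ ha _ hb

/-- By compactness, if every `M`-set containing `0` has an initial segment of density at most `α`,
then the length of that segment may be bounded uniformly. -/
theorem exists_uniform_bound {M : Set ℕ} {α : ℝ}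
    (h : ∀ S : Set ℕ, IsMSet M S → 0 ∈ S →
      ∃ k : ℕ, 0 < k ∧ (countBelow S k : ℝ) ≤ ((k : ℝ) + 1) * α) :
    ∃ N : ℕ, ∀ S : Set ℕ, IsMSet M S → 0 ∈ S →
      ∃ k ≤ N, (countBelow S k : ℝ) ≤ ((k : ℝ) + 1) * α := by
  by_contra! hN
  choose T hM h0 hT using hN
  let u : Filter ℕ := hyperfilter ℕ
  have hu : u ≤ atTop := Nat.hyperfilter_le_atTop
  let L : Set ℕ := {n | ∀ᶠ N in u, n ∈ T N}
  have hL : IsMSet M L := by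
    intro a ha b hb
    obtain ⟨N, hNa, hNb⟩ := (Filter.Eventually.and ha hb).exists
    exact hM N a hNa b hNb
  obtain ⟨k, -, hk⟩ := h L hL (Eventually.of_forall h0)
  have hmem : ∀ n, ∀ᶠ N in u, (n ∈ L ↔ n ∈ T N) := by
    intro n
    by_cases hn : n ∈ L
    · filter_upwards [hn] with N hN using ⟨fun _ => hN, fun _ => hn⟩
    · filter_upwards [Ultrafilter.eventually_not.2 hn] with N hN
      exact ⟨fun h => absurd h hn, fun h => absurd h hN⟩
  have hall : ∀ᶠ N in u, ∀ n ∈ Set.Iic k, (n ∈ L ↔ n ∈ T N) :=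
    (Filter.eventually_all_finite (Set.finite_Iic k)).2 fun n _ => hmem n
  obtain ⟨N, hN, hkN⟩ := (hall.and (hu (eventually_ge_atTop k))).exists
  have heq : L ∩ Set.Iic k = T N ∩ Set.Iic k := by
    ext n
    exact and_congr_left fun hn => hN n hn
  refine absurd hk (not_le.2 ?_)
  rw [countBelow, heq]
  exact hT N k hkN

open Classical in
/-- Covering an `M`-set greedily by blocks of density at most `α` bounds its counting function. -/
theorem count_le_of_uniform_bound {M : Set ℕ} {α : ℝ} (hα : 0 ≤ α) {N : ℕ}
    (h : ∀ S : Set ℕ, IsMSet M S → 0 ∈ S →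
      ∃ k ≤ N, (countBelow S k : ℝ) ≤ ((k : ℝ) + 1) * α) (n : ℕ) :
    ∀ S : Set ℕ, IsMSet M S → (Nat.count (· ∈ S) n : ℝ) ≤ α * n + N := by
  induction n using Nat.strong_induction_on with
  | _ n ih =>
    intro S hS
    by_cases hn : n ≤ N
    · have h1 : (Nat.count (· ∈ S) n : ℝ) ≤ N := by exact_mod_cast (Nat.count_le (p := (· ∈ S))).trans hn
      have : 0 ≤ α * n := by positivity
      linarith
    obtain ⟨k, hkN, hk⟩ : ∃ k ≤ N, (Nat.count (· ∈ S) (k + 1) : ℝ) ≤ ((k : ℝ) + 1) * α := by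
      by_cases h0 : 0 ∈ S
      · simpa only [countBelow_eq_count] using h S hS h0
      · exact ⟨0, Nat.zero_le _, by simpa [Nat.count_succ, h0] using hα⟩
    obtain ⟨m, rfl⟩ : ∃ m, n = (k + 1) + m := Nat.exists_eq_add_of_le (by omega)
    have hm := ih m (by omega) _ (hS.shift (k + 1))
    rw [Nat.count_add]
    simp only [Set.mem_ofPred_eq] at hm
    push_cast
    linarith

theorem IsMSet.upperDensity_le {M S : Set ℕ} {α : ℝ} (hα : 0 ≤ α) {N : ℕ}
    (h : ∀ S : Set ℕ, IsMSet M S → 0 ∈ S →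
      ∃ k ≤ N, (countBelow S k : ℝ) ≤ ((k : ℝ) + 1) * α) (hS : IsMSet M S) :
    upperDensity S ≤ α := by
  classical
  have hlim : Tendsto (fun x : ℕ => α + (α + N) / (x : ℝ)) atTop (nhds α) := by
    simpa using tendsto_const_nhds.add (tendsto_const_div_atTop_nhds_zero_nat (α + N))
  rw [← hlim.limsup_eq]
  refine limsup_le_limsup ?_ ?_ hlim.isBoundedUnder_le
  · filter_upwards [eventually_gt_atTop 0] with x hx
    have hx' : (0 : ℝ) < x := by exact_mod_cast hx
    have hc := count_le_of_uniform_bound hα h (x + 1) S hS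
    rw [← countBelow_eq_count] at hc
    push_cast at hc
    rw [div_le_iff₀ hx', add_mul, div_mul_cancel₀ _ hx'.ne']
    linarith
  · exact (isBoundedUnder_of ⟨0, fun x => by positivity⟩ :
      IsBoundedUnder (· ≥ ·) atTop _).isCoboundedUnder_le

/-- Lemma 2 (Haralambis): If `0 ≤ α ≤ 1` and every `M`-set `S` with `0 ∈ S` admits a
positive integer `k` with `S(k) ≤ (k+1)α`, then `μ(M) ≤ α`. -/
theorem stmt14 (M : Set ℕ) (hpos : ∀ k ∈ M, 0 < k)
    (α : ℝ) (hα0 : 0 ≤ α) (hα1 : α ≤ 1)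
    (h : ∀ S : Set ℕ, IsMSet M S → 0 ∈ S →
      ∃ k : ℕ, 0 < k ∧ (countBelow S k : ℝ) ≤ ((k : ℝ) + 1) * α) :
    muM M ≤ α := by
  obtain ⟨N, hN⟩ := exists_uniform_bound h
  refine Real.sSup_le ?_ hα0
  rintro _ ⟨S, hS, rfl⟩
  exact hS.upperDensity_le hα0 hN
end
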